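/- arXiv:1702.05327 — 2 statements merged into one kernel-verified Lean document; each statement's English description precedes it below -/
import Mathlib

section
/- Let x⋆ ∈ ℝ^N be nonzero, δ ∈ (0,1], let a₀ ∈ ℝ^N be a unit vector with ⟨a₀, x⋆⟩ ≥ δ‖x⋆‖₂, and let Ω : ℝ^N → ℝ be convex with subdifferential ∂Ω(x⋆). Then the set of ascent directions A = {h ∈ ℝ^N : ⟨a₀ − g, h⟩ ≥ 0 for all g ∈ ∂Ω(x⋆)} is contained in A_δ = {h ∈ ℝ^N : √(1−δ²)·‖h‖₂ + ⟨δ·x⋆/‖x⋆‖₂ − g, h⟩ ≥ 0 for all g ∈ ∂Ω(x⋆)}. -/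
open scoped RealInnerProductSpace

/-- The subdifferential of a convex function `Reg` at `x`:
`∂Reg(x) = {g : Reg (x+z) ≥ Reg x + ⟪g, z⟫ for all z}`. -/
def subdiff {N : ℕ} (Reg : EuclideanSpace ℝ (Fin N) → ℝ) (x : EuclideanSpace ℝ (Fin N)) :
    Set (EuclideanSpace ℝ (Fin N)) :=
  {g | ∀ z, Reg (x + z) ≥ Reg x + ⟪g, z⟫}

/-- The set of ascent directions
`A = {h : ⟪a₀ − g, h⟫ ≥ 0 for all g ∈ ∂Ω(xs)}` is contained in
`A_δ = {h : √(1−δ²)‖h‖ + ⟪δ·xs/‖xs‖ − g, h⟫ ≥ 0 for all g ∈ ∂Ω(xs)}`. -/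
theorem ascent_set_subset {N : ℕ} (xs a₀ : EuclideanSpace ℝ (Fin N))
    (hx : xs ≠ 0) (δ : ℝ) (hδ : δ ∈ Set.Ioc (0 : ℝ) 1)
    (ha₀ : ‖a₀‖ = 1) (hanchor : ⟪a₀, xs⟫ ≥ δ * ‖xs‖)
    (Reg : EuclideanSpace ℝ (Fin N) → ℝ) (hReg : ConvexOn ℝ Set.univ Reg) :
    {h : EuclideanSpace ℝ (Fin N) | ∀ g ∈ subdiff Reg xs, ⟪a₀ - g, h⟫ ≥ 0} ⊆
      {h : EuclideanSpace ℝ (Fin N) | ∀ g ∈ subdiff Reg xs,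
        Real.sqrt (1 - δ ^ 2) * ‖h‖ + ⟪(δ / ‖xs‖) • xs - g, h⟫ ≥ 0} := by
  intro h hh g hg
  have hA := hh g hg
  obtain ⟨hδ0, hδ1⟩ := hδ
  have hn : 0 < ‖xs‖ := norm_pos_iff.mpr hx
  have hsq : ‖a₀ - (δ / ‖xs‖) • xs‖ ^ 2 ≤ 1 - δ ^ 2 := by
    rw [norm_sub_sq_real, inner_smul_right, norm_smul, ha₀, Real.norm_eq_abs,
      abs_of_pos (div_pos hδ0 hn), div_mul_cancel₀ _ hn.ne']
    have h1 : δ / ‖xs‖ * (δ * ‖xs‖) ≤ δ / ‖xs‖ * ⟪a₀, xs⟫ :=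
      mul_le_mul_of_nonneg_left hanchor (div_pos hδ0 hn).le
    have h2 : δ / ‖xs‖ * (δ * ‖xs‖) = δ ^ 2 := by
      field_simp
    linarith
  have hle : ‖a₀ - (δ / ‖xs‖) • xs‖ ≤ Real.sqrt (1 - δ ^ 2) := Real.le_sqrt_of_sq_le hsq
  have hcs := real_inner_le_norm (a₀ - (δ / ‖xs‖) • xs) h
  have hm := mul_le_mul_of_nonneg_right hle (norm_nonneg h)
  have e1 : ⟪a₀ - g, h⟫ = ⟪a₀ - (δ / ‖xs‖) • xs, h⟫ + ⟪(δ / ‖xs‖) • xs - g, h⟫ := by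
    rw [← inner_add_left, sub_add_sub_cancel]
  linarith
end

section
/- Let f₁, …, f_M : ℝ^N → ℝ be differentiable convex functions, x⋆ ∈ ℝ^N, y_m = f_m(x⋆) + ξ_m for real numbers ξ_m, and define R_M⁺(x) = (1/M)·Σ_{m=1}^M (f_m(x) − y_m)₊. For t ≥ 0 let ψ_t(s) = (s)₊ − (s − t)₊. Then for every τ > 0 and every h ∈ ℝ^N, R_M⁺(x⋆ + h) ≥ (1/M)·Σ_{m=1}^M ψ_{τ‖h‖₂}(⟨∇f_m(x⋆), h⟩) − (1/M)·Σ_{m=1}^M (ξ_m)₊. -/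
open scoped RealInnerProductSpace

/-- `ψ_t(s) = (s)₊ − (s − t)₊`. -/
def psiTrunc (t s : ℝ) : ℝ := max s 0 - max (s - t) 0

theorem grad_ineq_aux {N : ℕ} (f : EuclideanSpace ℝ (Fin N) → ℝ)
    (hc : ConvexOn ℝ Set.univ f) (hd : Differentiable ℝ f)
    (x h : EuclideanSpace ℝ (Fin N)) :
    ⟪gradient f x, h⟫ ≤ f (x + h) - f x := by
  have hg : ConvexOn ℝ Set.univ (fun t : ℝ => f (x + t • h)) := by
    refine ⟨convex_univ, fun a _ b _ p q hp hq hpq => ?_⟩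
    have := hc.2 (Set.mem_univ (x + a • h)) (Set.mem_univ (x + b • h)) hp hq hpq
    have e : x + (p • a + q • b) • h = p • (x + a • h) + q • (x + b • h) := by
      have hx : x = (p + q) • x := by rw [hpq, one_smul]
      nth_rewrite 1 [hx]
      simp only [smul_eq_mul]
      module
    simp only [e]
    exact this
  have hD : HasDerivAt (fun t : ℝ => f (x + t • h)) ⟪gradient f x, h⟫ 0 := by
    have h1 : HasDerivAt (fun t : ℝ => x + t • h) h 0 := by
      simpa using ((hasDerivAt_id (0 : ℝ)).smul_const h).const_add x
    have h2 : HasFDerivAt f (InnerProductSpace.toDual ℝ _ (gradient f x)) (x + (0 : ℝ) • h) := by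
      simpa using (hd x).hasGradientAt.hasFDerivAt
    exact h2.comp_hasDerivAt (0 : ℝ) h1
  have := hg.le_slope_of_hasDerivAt (Set.mem_univ 0) (Set.mem_univ 1) one_pos hD
  simpa [slope_def_field] using this

/-- For differentiable convex `f_m`, observations
`y_m = f_m(xs) + ξ_m`, and `R_M⁺(x) = (1/M)·Σ (f_m x − y_m)₊`, for every `τ > 0` and `h`,
`R_M⁺(xs + h) ≥ (1/M)·Σ ψ_{τ‖h‖}(⟪∇f_m(xs), h⟫) − (1/M)·Σ (ξ_m)₊`. -/
theorem one_sided_loss_lower_bound {N M : ℕ}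
    (f : Fin M → EuclideanSpace ℝ (Fin N) → ℝ)
    (hconv : ∀ m, ConvexOn ℝ Set.univ (f m))
    (hdiff : ∀ m, Differentiable ℝ (f m))
    (xs : EuclideanSpace ℝ (Fin N)) (ξ : Fin M → ℝ) (y : Fin M → ℝ)
    (hy : ∀ m, y m = f m xs + ξ m)
    (τ : ℝ) (hτ : 0 < τ) (h : EuclideanSpace ℝ (Fin N)) :
    (M : ℝ)⁻¹ * ∑ m, max (f m (xs + h) - y m) 0 ≥
      (M : ℝ)⁻¹ * ∑ m, psiTrunc (τ * ‖h‖) ⟪gradient (f m) xs, h⟫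
        - (M : ℝ)⁻¹ * ∑ m, max (ξ m) 0 := by
  rw [← mul_sub, ← Finset.sum_sub_distrib]
  refine mul_le_mul_of_nonneg_left (Finset.sum_le_sum fun m _ => ?_) (by positivity)
  have h1 := grad_ineq_aux (f m) (hconv m) (hdiff m) xs h
  rw [hy m]
  unfold psiTrunc
  have h2 := le_max_right (⟪gradient (f m) xs, h⟫ - τ * ‖h‖) 0
  have h3 := le_max_left (ξ m) 0
  have h4 := le_max_right (ξ m) 0
  have h5 := le_max_left (f m (xs + h) - (f m xs + ξ m)) 0
  have h6 := le_max_right (f m (xs + h) - (f m xs + ξ m)) 0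
  rcases max_cases (⟪gradient (f m) xs, h⟫) (0 : ℝ) with h7 | h7 <;> linarith [h7.1]
end
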